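/- Let S and A be nonempty measurable spaces, r : S × A → ℝ, γ ∈ (0,1), and κ a Markov kernel from S × A to S. Let α, β ∈ [0,1], U ⊆ S × A, and H : S × A → ℝ with H(x) > 0 for every x ∈ U. Let Q, Q_prev, Q* : S × A → ℝ be bounded functions with 𝓑Q* = Q*, suppose that for every (s,a) the functions s' ↦ ⨆_{a'} Q_prev(s',a'), s' ↦ ⨆_{a'} G_{Q_prev}(s',a'), and s' ↦ ⨆_{a'} Q*(s',a') are integrable with respect to κ(s,a), and assume the event hypothesis for Q_prev: for every x ∈ U, |1 − 1/H(x)|·|Q_prev(x)| ≤ (1−β)·⨆_{y} |Q_prev(y)|. Then for every (s,a): |Q(s,a) − Q*(s,a)| ≤ ⨆_{x} |Q(x) − 𝓕Q_prev(x)| + γ·(1−α)·(1−β)·⨆_{x} |Q_prev(x)| + γ·⨆_{x} |Q_prev(x) − Q*(x)|. -/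

import Mathlib

open MeasureTheory ProbabilityTheory

open Classical in
/-- The blended (uncertainty-penalized) target of QDQ: on the high-uncertainty set `U` the
Q-value is weighted by `1/H`, and off `U` it is weighted by `β`, mixed with the unpenalized
value with weight `α`. -/
noncomputable def blendedTarget {X : Type*} (U : Set X) (H : X → ℝ) (α β : ℝ)
    (Q : X → ℝ) (x : X) : ℝ :=
  α * Q x + (1 - α) * (if x ∈ U then Q x / H x else β * Q x)

/-- The QDQ Bellman operator
`(𝓕Q)(s,a) = r(s,a) + γ ∫ (⨆ a', G_Q(s',a')) dκ(s,a)(s')`, where `G_Q` is the blended target. -/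
noncomputable def qdqBellman {S A : Type*} [MeasurableSpace S] [MeasurableSpace A]
    (r : S × A → ℝ) (γ : ℝ) (κ : Kernel (S × A) S) (U : Set (S × A)) (H : S × A → ℝ)
    (α β : ℝ) (Q : S × A → ℝ) (p : S × A) : ℝ :=
  r p + γ * ∫ s', (⨆ a' : A, blendedTarget U H α β Q (s', a')) ∂(κ p)

/-- The classical (optimal) Bellman operator
`(𝓑Q)(s,a) = r(s,a) + γ ∫ (⨆ a', Q(s',a')) dκ(s,a)(s')`. -/
noncomputable def classicalBellman {S A : Type*} [MeasurableSpace S] [MeasurableSpace A]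
    (r : S × A → ℝ) (γ : ℝ) (κ : Kernel (S × A) S) (Q : S × A → ℝ) (p : S × A) : ℝ :=
  r p + γ * ∫ s', (⨆ a' : A, Q (s', a')) ∂(κ p)

theorem abs_ciSup_sub_ciSup_le {ι : Type*} [Nonempty ι] {f g : ι → ℝ} {c : ℝ}
    (hf : BddAbove (Set.range f)) (hg : BddAbove (Set.range g)) (h : ∀ i, |f i - g i| ≤ c) :
    |(⨆ i, f i) - ⨆ i, g i| ≤ c := by
  refine abs_sub_le_iff.2 ⟨sub_le_iff_le_add.2 (ciSup_le fun i => ?_),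
    sub_le_iff_le_add.2 (ciSup_le fun i => ?_)⟩
  · linarith [(abs_sub_le_iff.1 (h i)).1, le_ciSup hg i]
  · linarith [(abs_sub_le_iff.1 (h i)).2, le_ciSup hf i]

theorem abs_integral_sub_integral_le {Ω : Type*} [MeasurableSpace Ω] {μ : Measure Ω}
    [IsProbabilityMeasure μ] {f g : Ω → ℝ} {c : ℝ} (hf : Integrable f μ) (hg : Integrable g μ)
    (h : ∀ x, |f x - g x| ≤ c) : |(∫ x, f x ∂μ) - ∫ x, g x ∂μ| ≤ c := by
  rw [← integral_sub hf hg]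
  simpa using norm_integral_le_of_norm_le_const (μ := μ) (f := fun x => f x - g x)
    (Filter.Eventually.of_forall h)

theorem abs_blendedTarget_sub_le {X : Type*} {U : Set X} {H Q : X → ℝ} {α β N : ℝ}
    (hα : α ≤ 1) (hβ : β ≤ 1) (hQ : ∀ x, |Q x| ≤ N)
    (hU : ∀ x ∈ U, |1 - 1 / H x| * |Q x| ≤ (1 - β) * N) (x : X) :
    |blendedTarget U H α β Q x - Q x| ≤ (1 - α) * (1 - β) * N := by
  have hα' : 0 ≤ 1 - α := sub_nonneg.2 hα
  have hβ' : 0 ≤ 1 - β := sub_nonneg.2 hβ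
  unfold blendedTarget
  split_ifs with hx
  · calc |α * Q x + (1 - α) * (Q x / H x) - Q x|
        = |-((1 - α) * ((1 - 1 / H x) * Q x))| := by ring_nf
      _ = (1 - α) * (|1 - 1 / H x| * |Q x|) := by
        rw [abs_neg, abs_mul, abs_mul, abs_of_nonneg hα']
      _ ≤ (1 - α) * ((1 - β) * N) := mul_le_mul_of_nonneg_left (hU x hx) hα'
      _ = (1 - α) * (1 - β) * N := by ring
  · calc |α * Q x + (1 - α) * (β * Q x) - Q x|
        = |-((1 - α) * (1 - β) * Q x)| := by ring_nf
      _ = (1 - α) * (1 - β) * |Q x| := by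
        rw [abs_neg, abs_mul, abs_of_nonneg (mul_nonneg hα' hβ')]
      _ ≤ (1 - α) * (1 - β) * N :=
        mul_le_mul_of_nonneg_left (hQ x) (mul_nonneg hα' hβ')

theorem abs_qdqBellman_sub_classicalBellman_le {S A : Type*} [MeasurableSpace S]
    [MeasurableSpace A] [Nonempty A] (r : S × A → ℝ) {γ : ℝ} (hγ : 0 ≤ γ)
    (κ : Kernel (S × A) S) [IsMarkovKernel κ] {U : Set (S × A)} {H : S × A → ℝ} {α β : ℝ}
    {Q Q' : S × A → ℝ} {M c : ℝ} (hQ' : ∀ x, |Q' x| ≤ M)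
    (h : ∀ x, |blendedTarget U H α β Q x - Q' x| ≤ c) (p : S × A)
    (hintG : Integrable (fun s' => ⨆ a' : A, blendedTarget U H α β Q (s', a')) (κ p))
    (hint : Integrable (fun s' => ⨆ a' : A, Q' (s', a')) (κ p)) :
    |qdqBellman r γ κ U H α β Q p - classicalBellman r γ κ Q' p| ≤ γ * c := by
  rw [qdqBellman, classicalBellman, add_sub_add_left_eq_sub, ← mul_sub, abs_mul,
    abs_of_nonneg hγ]
  refine mul_le_mul_of_nonneg_left (abs_integral_sub_integral_le hintG hint fun s =>
    abs_ciSup_sub_ciSup_le ⟨c + M, ?_⟩ ⟨M, ?_⟩ fun a => h (s, a)) hγ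
  · rintro _ ⟨a, rfl⟩
    linarith [(abs_sub_le_iff.1 (h (s, a))).1, (abs_le.1 (hQ' (s, a))).2]
  · rintro _ ⟨a, rfl⟩
    exact (abs_le.1 (hQ' (s, a))).2

/-- The Corollary of the QDQ paper (Eq. D.12, error propagation of QDQ value iteration): if
`Q*` is a fixed point of the classical Bellman operator `𝓑`, `Q` is the current iterate and
`Qprev` the previous iterate, then pointwise
`|Q(s,a) - Q*(s,a)| ≤ ⨆ x, |Q x - 𝓕Qprev x| + γ(1-α)(1-β) ⨆ x, |Qprev x| +
γ ⨆ x, |Qprev x - Q* x|`. -/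
theorem qdq_value_iteration_error_propagation {S A : Type*}
    [MeasurableSpace S] [MeasurableSpace A] [Nonempty S] [Nonempty A]
    (r : S × A → ℝ) (γ : ℝ) (hγ : γ ∈ Set.Ioo (0 : ℝ) 1)
    (κ : Kernel (S × A) S) [IsMarkovKernel κ]
    (α β : ℝ) (hα : α ∈ Set.Icc (0 : ℝ) 1) (hβ : β ∈ Set.Icc (0 : ℝ) 1)
    (U : Set (S × A)) (H : S × A → ℝ) (hH : ∀ x ∈ U, 0 < H x)
    (Q Qprev Qstar : S × A → ℝ) (M : ℝ)
    (hQ : ∀ x, |Q x| ≤ M) (hQprev : ∀ x, |Qprev x| ≤ M) (hQstar : ∀ x, |Qstar x| ≤ M)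
    (hfixStar : classicalBellman r γ κ Qstar = Qstar)
    (hintPrev : ∀ p : S × A, Integrable (fun s' => ⨆ a' : A, Qprev (s', a')) (κ p))
    (hintGPrev : ∀ p : S × A,
      Integrable (fun s' => ⨆ a' : A, blendedTarget U H α β Qprev (s', a')) (κ p))
    (hintStar : ∀ p : S × A, Integrable (fun s' => ⨆ a' : A, Qstar (s', a')) (κ p))
    (hevent : ∀ x ∈ U, |1 - 1 / H x| * |Qprev x| ≤ (1 - β) * ⨆ y : S × A, |Qprev y|) :
    ∀ p : S × A,
      |Q p - Qstar p| ≤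
        (⨆ x : S × A, |Q x - qdqBellman r γ κ U H α β Qprev x|) +
          γ * (1 - α) * (1 - β) * (⨆ x : S × A, |Qprev x|) +
          γ * ⨆ x : S × A, |Qprev x - Qstar x| := by
  have hprev (x) : |Qprev x| ≤ ⨆ y, |Qprev y| :=
    le_ciSup (f := fun y => |Qprev y|) ⟨M, Set.forall_mem_range.2 hQprev⟩ x
  have hdiff (x) : |Qprev x - Qstar x| ≤ ⨆ y, |Qprev y - Qstar y| :=
    le_ciSup (f := fun y => |Qprev y - Qstar y|)
      ⟨M + M, Set.forall_mem_range.2 fun y =>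
        (abs_sub _ _).trans (add_le_add (hQprev y) (hQstar y))⟩ x
  set N := ⨆ y, |Qprev y|
  set D := ⨆ y, |Qprev y - Qstar y|
  have hblend (x) : |blendedTarget U H α β Qprev x - Qstar x| ≤ (1 - α) * (1 - β) * N + D :=
    (abs_sub_le _ (Qprev x) _).trans
      (add_le_add (abs_blendedTarget_sub_le hα.2 hβ.2 hprev hevent x) (hdiff x))
  have hbellman (x) : |qdqBellman r γ κ U H α β Qprev x - Qstar x| ≤
      γ * ((1 - α) * (1 - β) * N + D) := by
    have h := abs_qdqBellman_sub_classicalBellman_le r hγ.1.le κ hQstar hblend x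
      (hintGPrev x) (hintStar x)
    rwa [hfixStar] at h
  have hbdd : BddAbove (Set.range fun x => |Q x - qdqBellman r γ κ U H α β Qprev x|) := by
    refine ⟨M + M + γ * ((1 - α) * (1 - β) * N + D), Set.forall_mem_range.2 fun x => ?_⟩
    refine (abs_sub_le _ (Qstar x) _).trans (add_le_add ?_ ?_)
    · exact (abs_sub _ _).trans (add_le_add (hQ x) (hQstar x))
    · rw [abs_sub_comm]
      exact hbellman x
  intro p
  linarith [abs_sub_le (Q p) (qdqBellman r γ κ U H α β Qprev p) (Qstar p), le_ciSup hbdd p,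
    hbellman p]
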